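/- For every real β > 0 and all θ ≤ θ′ in ℝ, the size-biased tail distribution μ̂^{θ′} stochastically dominates μ̂^θ: for every y ∈ ℤ one has ∑_{m ≤ y} μ̂^{θ′}(m) ≤ ∑_{m ≤ y} μ̂^θ(m). -/

import Mathlib

open scoped BigOperators

/-- Partition function \`Z(θ) = ∑_{z ∈ ℤ} exp(θ z − β z²/2)\`. -/
noncomputable def Zf (β θ : ℝ) : ℝ := ∑' z : ℤ, Real.exp (θ * (z : ℝ) - β * (z : ℝ)^2 / 2)

/-- Discrete Gaussian probability mass function \`μ^θ(z) = exp(θ z − β z²/2)/Z(θ)\`. -/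
noncomputable def mu (β θ : ℝ) (z : ℤ) : ℝ := Real.exp (θ * (z : ℝ) - β * (z : ℝ)^2 / 2) / Zf β θ

/-- The mean (density) \`R(θ) = ∑_{z ∈ ℤ} z μ^θ(z)\`. -/
noncomputable def Rmean (β θ : ℝ) : ℝ := ∑' z : ℤ, (z : ℝ) * mu β θ z


/-- The variance \`Var(θ) = ∑_{z ∈ ℤ} (z − R(θ))² μ^θ(z)\`. -/
noncomputable def Varmu (β θ : ℝ) : ℝ := ∑' z : ℤ, ((z : ℝ) - Rmean β θ)^2 * mu β θ z

/-- The tail sum \`T^θ(y) = ∑_{z > y} (z − R(θ)) μ^θ(z)\`. -/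
noncomputable def Ttail (β θ : ℝ) (y : ℤ) : ℝ :=
  ∑' z : {z : ℤ // y < z}, (((z : ℤ) : ℝ) - Rmean β θ) * mu β θ (z : ℤ)

/-- The size-biased tail distribution \`μ̂^θ(y) = T^θ(y)/Var(θ)\`. -/
noncomputable def muhat (β θ : ℝ) (y : ℤ) : ℝ := Ttail β θ y / Varmu β θ

/-- The four functions theorem for summable functions on a possibly infinite distributive
lattice. -/
theorem four_functions_theorem_tsum {α : Type*} [DistribLattice α] {f₁ f₂ f₃ f₄ : α → ℝ}
    (h₁ : 0 ≤ f₁) (h₂ : 0 ≤ f₂) (h₃ : 0 ≤ f₃) (h₄ : 0 ≤ f₄)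
    (h : ∀ a b, f₁ a * f₂ b ≤ f₃ (a ⊓ b) * f₄ (a ⊔ b))
    (s₁ : Summable f₁) (s₂ : Summable f₂) (s₃ : Summable f₃) (s₄ : Summable f₄) :
    (∑' a, f₁ a) * ∑' a, f₂ a ≤ (∑' a, f₃ a) * ∑' a, f₄ a := by
  classical
  have hlim := Filter.Tendsto.mul s₁.hasSum s₂.hasSum
  refine le_of_tendsto' hlim fun s ↦ ?_
  refine (four_functions_theorem f₁ f₂ f₃ f₄ h₁ h₂ h₃ h₄ h s s).trans ?_
  exact mul_le_mul (s₃.sum_le_tsum _ fun i _ ↦ h₃ i) (s₄.sum_le_tsum _ fun i _ ↦ h₄ i)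
    (Finset.sum_nonneg fun i _ ↦ h₄ i) (tsum_nonneg h₃)

/-- The weight `(a - b) p(a) p(b) 1{b ≤ m < a}` on triples `((a, b), m)`. -/
noncomputable def crossWeight (p : ℤ → ℝ) (x : (ℤ × ℤ) × ℤ) : ℝ :=
  if x.1.2 ≤ x.2 ∧ x.2 < x.1.1 then ((x.1.1 : ℝ) - x.1.2) * (p x.1.1 * p x.1.2) else 0

theorem crossWeight_nonneg {p : ℤ → ℝ} (hp : ∀ z, 0 ≤ p z) (x : (ℤ × ℤ) × ℤ) :
    0 ≤ crossWeight p x := by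
  unfold crossWeight
  split_ifs with h
  · have : (x.1.2 : ℝ) ≤ x.1.1 := by exact_mod_cast (h.1.trans_lt h.2).le
    exact mul_nonneg (sub_nonneg.2 this) (mul_nonneg (hp _) (hp _))
  · exact le_rfl

theorem sub_mul_sub_le_inf_sup (a b c d : ℤ) :
    (a - b) * (c - d) ≤ (a ⊓ c - b ⊓ d) * (a ⊔ c - b ⊔ d) := by
  rcases le_total a c with h | h <;> rcases le_total b d with h' | h' <;>
    simp only [inf_of_le_left, inf_of_le_right, sup_of_le_left, sup_of_le_right, h, h'] <;>
    nlinarith [mul_nonneg (sub_nonneg.2 h) (sub_nonneg.2 h')]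

/-- If the ratio of `q` to `p` is monotone, the weights built from `q` and `p` satisfy the
Holley condition. -/
theorem crossWeight_mul_le {p q : ℤ → ℝ} (hp : ∀ z, 0 ≤ p z) (hq : ∀ z, 0 ≤ q z)
    (h : ∀ a c, q a * p c ≤ p (a ⊓ c) * q (a ⊔ c)) (x y : (ℤ × ℤ) × ℤ) :
    crossWeight q x * crossWeight p y ≤ crossWeight p (x ⊓ y) * crossWeight q (x ⊔ y) := by
  by_cases hx : x.1.2 ≤ x.2 ∧ x.2 < x.1.1
  swap
  · rw [crossWeight, if_neg hx, zero_mul]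
    exact mul_nonneg (crossWeight_nonneg hp _) (crossWeight_nonneg hq _)
  by_cases hy : y.1.2 ≤ y.2 ∧ y.2 < y.1.1
  swap
  · rw [crossWeight.eq_1 p y, if_neg hy, mul_zero]
    exact mul_nonneg (crossWeight_nonneg hp _) (crossWeight_nonneg hq _)
  obtain ⟨⟨a, b⟩, m⟩ := x
  obtain ⟨⟨c, d⟩, n⟩ := y
  dsimp only at hx hy
  have hinf : b ⊓ d ≤ m ⊓ n ∧ m ⊓ n < a ⊓ c := by omega
  have hsup : b ⊔ d ≤ m ⊔ n ∧ m ⊔ n < a ⊔ c := by omega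
  simp only [crossWeight, Prod.mk_inf_mk, Prod.mk_sup_mk, if_pos hx, if_pos hy, if_pos hinf,
    if_pos hsup]
  have key : ((a : ℝ) - b) * (c - d) ≤
      (((a ⊓ c : ℤ) : ℝ) - (b ⊓ d : ℤ)) * ((a ⊔ c : ℤ) - (b ⊔ d : ℤ)) := by
    exact_mod_cast sub_mul_sub_le_inf_sup a b c d
  have hnn : 0 ≤ ((a : ℝ) - b) * (c - d) := by
    have h1 : (b : ℝ) ≤ a := by exact_mod_cast (hx.1.trans_lt hx.2).le
    have h2 : (d : ℝ) ≤ c := by exact_mod_cast (hy.1.trans_lt hy.2).le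
    exact mul_nonneg (sub_nonneg.2 h1) (sub_nonneg.2 h2)
  calc _ = (((a : ℝ) - b) * (c - d)) * ((q a * p c) * (q b * p d)) := by ring
    _ ≤ ((((a ⊓ c : ℤ) : ℝ) - (b ⊓ d : ℤ)) * ((a ⊔ c : ℤ) - (b ⊔ d : ℤ))) *
        ((p (a ⊓ c) * q (a ⊔ c)) * (p (b ⊓ d) * q (b ⊔ d))) := by
      refine mul_le_mul key ?_ ?_ (hnn.trans key)
      · exact mul_le_mul (h a c) (h b d) (mul_nonneg (hq _) (hp _))
          (mul_nonneg (hp _) (hq _))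
      · exact mul_nonneg (mul_nonneg (hq _) (hp _)) (mul_nonneg (hq _) (hp _))
    _ = _ := by ring

/-- `∑_m (a - b) p(a) p(b) 1{b ≤ m < a} = (a - b)² p(a) p(b) 1{b < a}`. -/
theorem hasSum_crossWeight_right (p : ℤ → ℝ) (x : ℤ × ℤ) :
    HasSum (fun m ↦ crossWeight p (x, m))
      (if x.2 < x.1 then ((x.1 : ℝ) - x.2) ^ 2 * (p x.1 * p x.2) else 0) := by
  have h : HasSum (fun m ↦ crossWeight p (x, m))
      (∑ m ∈ Finset.Ico x.2 x.1, crossWeight p (x, m)) :=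
    hasSum_sum_of_ne_finset_zero fun m hm ↦ if_neg (by simpa using hm)
  convert h using 1
  have hterm : ∀ m ∈ Finset.Ico x.2 x.1, crossWeight p (x, m) =
      ((x.1 : ℝ) - x.2) * (p x.1 * p x.2) := fun m hm ↦ if_pos (Finset.mem_Ico.1 hm)
  rw [Finset.sum_congr rfl hterm, Finset.sum_const,
    Int.card_Ico, nsmul_eq_mul]
  split_ifs with hlt
  · have : (((x.1 - x.2).toNat : ℕ) : ℝ) = (x.1 : ℝ) - x.2 := by
      rw [← Int.cast_natCast, Int.toNat_of_nonneg (by omega)]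
      push_cast
      ring
    rw [this]
    ring
  · rw [Int.toNat_of_nonpos (by omega)]
    simp

section Moments

variable {p : ℤ → ℝ} {R M : ℝ}

theorem hasSum_mul_prod {f g : ℤ → ℝ} {s t : ℝ} (hf : HasSum f s) (hg : HasSum g t) :
    HasSum (fun x : ℤ × ℤ ↦ f x.1 * g x.2) (s * t) :=
  hf.mul hg (summable_mul_of_summable_norm hf.summable.norm hg.summable.norm)

/-- The sum of `(a - b)² p(a) p(b)` over all pairs is twice the variance. -/
theorem hasSum_sq_sub_mul (h0 : HasSum p 1) (h1 : HasSum (fun z : ℤ ↦ (z : ℝ) * p z) R)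
    (h2 : HasSum (fun z : ℤ ↦ (z : ℝ) ^ 2 * p z) M) :
    HasSum (fun x : ℤ × ℤ ↦ ((x.1 : ℝ) - x.2) ^ 2 * (p x.1 * p x.2)) (2 * (M - R ^ 2)) := by
  have h := ((hasSum_mul_prod h2 h0).add (hasSum_mul_prod h0 h2)).sub
    ((hasSum_mul_prod h1 h1).mul_left 2)
  rw [show 2 * (M - R ^ 2) = M * 1 + 1 * M - 2 * (R * R) by ring]
  refine (congrArg (HasSum · _) (funext fun x ↦ ?_)).mp h
  ring

theorem hasSum_variance (h0 : HasSum p 1) (h1 : HasSum (fun z : ℤ ↦ (z : ℝ) * p z) R)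
    (h2 : HasSum (fun z : ℤ ↦ (z : ℝ) ^ 2 * p z) M) :
    HasSum (fun z : ℤ ↦ ((z : ℝ) - R) ^ 2 * p z) (M - R ^ 2) := by
  have h := (h2.sub (h1.mul_left (2 * R))).add (h0.mul_left (R ^ 2))
  rw [show M - R ^ 2 = M - 2 * R * R + R ^ 2 * 1 by ring]
  refine (congrArg (HasSum · _) (funext fun x ↦ ?_)).mp h
  ring

theorem hasSum_ordered_sq_sub_mul (h0 : HasSum p 1)
    (h1 : HasSum (fun z : ℤ ↦ (z : ℝ) * p z) R) (h2 : HasSum (fun z : ℤ ↦ (z : ℝ) ^ 2 * p z) M) :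
    HasSum (fun x : ℤ × ℤ ↦ if x.2 < x.1 then ((x.1 : ℝ) - x.2) ^ 2 * (p x.1 * p x.2) else 0)
      (M - R ^ 2) := by
  set f : ℤ × ℤ → ℝ := fun x ↦ ((x.1 : ℝ) - x.2) ^ 2 * (p x.1 * p x.2) with hf
  have hfs : HasSum f _ := hasSum_sq_sub_mul h0 h1 h2
  have hs : Summable (fun x : ℤ × ℤ ↦ if x.2 < x.1 then f x else 0) :=
    (hfs.summable.indicator {x | x.2 < x.1}).congr fun x ↦ by simp [Set.indicator_apply]
  have hsum := hs.hasSum.add ((Equiv.prodComm ℤ ℤ).hasSum_iff.2 hs.hasSum)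
  have hfun : (fun x : ℤ × ℤ ↦ (if x.2 < x.1 then f x else 0) +
      ((fun x : ℤ × ℤ ↦ if x.2 < x.1 then f x else 0) ∘ (Equiv.prodComm ℤ ℤ)) x) = f := by
    funext ⟨a, b⟩
    rcases lt_trichotomy a b with h | h | h
    · simp only [hf, Function.comp, Equiv.prodComm_apply, Prod.swap, if_pos h, if_neg h.not_gt]
      ring
    · simp [hf, h]
    · simp [hf, h, h.not_gt]
  rw [hfun] at hsum
  have := hsum.unique hfs
  convert hs.hasSum using 1
  linarith

/-- The sum of `crossWeight p` over all triples is the variance of `p`. -/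
theorem hasSum_crossWeight (hp : ∀ z, 0 ≤ p z) (h0 : HasSum p 1)
    (h1 : HasSum (fun z : ℤ ↦ (z : ℝ) * p z) R) (h2 : HasSum (fun z : ℤ ↦ (z : ℝ) ^ 2 * p z) M) :
    HasSum (crossWeight p) (M - R ^ 2) := by
  have hord := hasSum_ordered_sq_sub_mul h0 h1 h2
  have hs : Summable (crossWeight p) := by
    refine (summable_prod_of_nonneg (crossWeight_nonneg hp)).2
      ⟨fun x ↦ (hasSum_crossWeight_right p x).summable, ?_⟩
    simpa only [(hasSum_crossWeight_right p _).tsum_eq] using hord.summable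
  rw [← (hs.hasSum.prod_fiberwise fun x ↦ hasSum_crossWeight_right p x).unique hord]
  exact hs.hasSum

/-- The centred tail sum of `p` as a sum over pairs separated by `m`. -/
theorem tsum_tail_eq (h0 : HasSum p 1) (h1 : HasSum (fun z : ℤ ↦ (z : ℝ) * p z) R) (m : ℤ) :
    ∑' z : {z : ℤ // m < z}, (((z : ℤ) : ℝ) - R) * p z = ∑' x, crossWeight p (x, m) := by
  set D : ℤ × ℤ → ℝ := fun x ↦ ((x.1 : ℝ) - x.2) * (p x.1 * p x.2) with hD
  have hDs : Summable D := by
    refine ((hasSum_mul_prod h1 h0).sub (hasSum_mul_prod h0 h1)).summable.congr fun x ↦ ?_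
    simp only [hD]
    ring
  have hind : ∀ S : Set (ℤ × ℤ), Summable (S.indicator D) := fun S ↦ hDs.indicator S
  have hsplit : {x : ℤ × ℤ | m < x.1}.indicator D =
      fun x ↦ crossWeight p (x, m) + {x : ℤ × ℤ | m < x.1 ∧ m < x.2}.indicator D x := by
    funext ⟨a, b⟩
    by_cases ha : m < a <;> by_cases hb : m < b <;>
      simp [crossWeight, hD, ha, hb, not_le.2, not_lt.1]
  have hcs : Summable fun x ↦ crossWeight p (x, m) :=
    (hind {x | x.2 ≤ m ∧ m < x.1}).congr fun x ↦ by
      simp [crossWeight, hD, Set.indicator_apply]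
  have hzero : ∑' x, {x : ℤ × ℤ | m < x.1 ∧ m < x.2}.indicator D x = 0 := by
    have h := (Equiv.prodComm ℤ ℤ).tsum_eq ({x : ℤ × ℤ | m < x.1 ∧ m < x.2}.indicator D)
    have hneg : ∀ x, {x : ℤ × ℤ | m < x.1 ∧ m < x.2}.indicator D (Equiv.prodComm ℤ ℤ x) =
        -{x : ℤ × ℤ | m < x.1 ∧ m < x.2}.indicator D x := by
      rintro ⟨a, b⟩
      by_cases ha : m < a <;> by_cases hb : m < b <;>
        simp [hD, ha, hb]
      ring
    simp only [hneg, tsum_neg] at h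
    linarith
  have hleft : ∑' x, {x : ℤ × ℤ | m < x.1}.indicator D x =
      ∑' z : {z : ℤ // m < z}, (((z : ℤ) : ℝ) - R) * p z := by
    rw [(hind _).tsum_prod]
    refine Eq.trans (tsum_congr fun a ↦ ?_)
      (tsum_subtype {z : ℤ | m < z} fun z ↦ ((z : ℝ) - R) * p z).symm
    by_cases ha : m < a
    · have h := ((h0.mul_left (a : ℝ)).sub h1).mul_left (p a)
      simp only [Set.indicator_apply, Set.mem_ofPred_eq, if_pos ha]
      convert h.tsum_eq using 1
      · refine tsum_congr fun b ↦ ?_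
        simp only [hD]
        ring
      · ring
    · simp [ha]
  rw [← hleft, hsplit, hcs.tsum_add (hind _), hzero, add_zero]

end Moments

theorem summable_pow_mul_exp (β θ : ℝ) (hβ : 0 < β) (k : ℕ) :
    Summable fun z : ℤ ↦ (z : ℝ) ^ k * Real.exp (θ * z - β * (z : ℝ) ^ 2 / 2) := by
  have h := summable_pow_mul_jacobiTheta₂_term_bound (|θ| / (2 * Real.pi))
    (T := β / (2 * Real.pi)) (by positivity) k
  refine Summable.of_norm_bounded h fun z ↦ ?_
  rw [norm_mul, norm_pow, Real.norm_eq_abs, Real.norm_eq_abs, Real.abs_exp]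
  push_cast
  refine mul_le_mul_of_nonneg_left (Real.exp_le_exp.2 ?_) (by positivity)
  have hθz : θ * z ≤ |θ| * |(z : ℝ)| := (le_abs_self _).trans (abs_mul _ _).le
  have : -Real.pi * (β / (2 * Real.pi) * (z : ℝ) ^ 2 - 2 * (|θ| / (2 * Real.pi)) * |(z : ℝ)|) =
      |θ| * |(z : ℝ)| - β * (z : ℝ) ^ 2 / 2 := by
    field_simp
    ring
  rw [this]
  linarith

theorem Zf_pos {β : ℝ} (hβ : 0 < β) (θ : ℝ) : 0 < Zf β θ :=
  Summable.tsum_pos (by simpa using summable_pow_mul_exp β θ hβ 0)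
    (fun _ ↦ (Real.exp_pos _).le) 0 (Real.exp_pos _)

theorem mu_pos {β : ℝ} (hβ : 0 < β) (θ : ℝ) (z : ℤ) : 0 < mu β θ z :=
  div_pos (Real.exp_pos _) (Zf_pos hβ θ)

theorem summable_pow_mul_mu {β : ℝ} (hβ : 0 < β) (θ : ℝ) (k : ℕ) :
    Summable fun z : ℤ ↦ (z : ℝ) ^ k * mu β θ z := by
  simpa only [mu, mul_div_assoc] using (summable_pow_mul_exp β θ hβ k).div_const (Zf β θ)

theorem hasSum_mu {β : ℝ} (hβ : 0 < β) (θ : ℝ) : HasSum (mu β θ) 1 := by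
  have h : Summable fun z : ℤ ↦ Real.exp (θ * z - β * (z : ℝ) ^ 2 / 2) := by
    simpa using summable_pow_mul_exp β θ hβ 0
  have := h.hasSum.div_const (Zf β θ)
  rwa [← Zf.eq_1, div_self (Zf_pos hβ θ).ne'] at this

theorem hasSum_mul_mu {β : ℝ} (hβ : 0 < β) (θ : ℝ) :
    HasSum (fun z : ℤ ↦ (z : ℝ) * mu β θ z) (Rmean β θ) := by
  have h : Summable fun z : ℤ ↦ (z : ℝ) * mu β θ z := by
    simpa using summable_pow_mul_mu hβ θ 1
  exact h.hasSum

theorem hasSum_crossWeight_mu {β : ℝ} (hβ : 0 < β) (θ : ℝ) :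
    HasSum (crossWeight (mu β θ)) (Varmu β θ) := by
  have h0 := hasSum_mu hβ θ
  have h1 := hasSum_mul_mu hβ θ
  have h2 := (summable_pow_mul_mu hβ θ 2).hasSum
  rw [Varmu, (hasSum_variance h0 h1 h2).tsum_eq]
  exact hasSum_crossWeight (fun z ↦ (mu_pos hβ θ z).le) h0 h1 h2

theorem Varmu_pos {β : ℝ} (hβ : 0 < β) (θ : ℝ) : 0 < Varmu β θ := by
  have h := hasSum_crossWeight_mu hβ θ
  rw [← h.tsum_eq]
  refine h.summable.tsum_pos (crossWeight_nonneg fun z ↦ (mu_pos hβ θ z).le) ((1, 0), 0) ?_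
  simpa [crossWeight] using mul_pos (mu_pos hβ θ 1) (mu_pos hβ θ 0)

theorem mu_mul_mu_le {β θ θ' : ℝ} (hβ : 0 < β) (hθ : θ ≤ θ') (a c : ℤ) :
    mu β θ' a * mu β θ c ≤ mu β θ (a ⊓ c) * mu β θ' (a ⊔ c) := by
  rcases le_total a c with h | h
  · rw [inf_of_le_left h, sup_of_le_right h]
    have hZ := Zf_pos hβ θ
    have hZ' := Zf_pos hβ θ'
    have hac : (a : ℝ) ≤ c := by exact_mod_cast h
    simp only [mu, div_mul_div_comm, ← Real.exp_add]
    rw [mul_comm (Zf β θ')]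
    refine div_le_div_of_nonneg_right (Real.exp_le_exp.2 ?_) (mul_pos hZ hZ').le
    nlinarith [mul_nonneg (sub_nonneg.2 hθ) (sub_nonneg.2 hac)]
  · rw [inf_of_le_right h, sup_of_le_left h, mul_comm]

theorem tsum_muhat_eq {β : ℝ} (hβ : 0 < β) (θ : ℝ) (y : ℤ) :
    ∑' m : {m : ℤ // m ≤ y}, muhat β θ m =
      (∑' x, {x : (ℤ × ℤ) × ℤ | x.2 ≤ y}.indicator (crossWeight (mu β θ)) x) / Varmu β θ := by
  have hT : ∀ m, Ttail β θ m = ∑' x, crossWeight (mu β θ) (x, m) :=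
    tsum_tail_eq (hasSum_mu hβ θ) (hasSum_mul_mu hβ θ)
  have hs := (hasSum_crossWeight_mu hβ θ).summable.indicator {x : (ℤ × ℤ) × ℤ | x.2 ≤ y}
  simp only [muhat, tsum_div_const]
  congr 1
  rw [← (Equiv.prodComm ℤ (ℤ × ℤ)).tsum_eq]
  refine Eq.trans ?_ ((Equiv.prodComm ℤ (ℤ × ℤ)).summable_iff.2 hs).tsum_prod.symm
  refine (tsum_subtype {m : ℤ | m ≤ y} (Ttail β θ)).trans (tsum_congr fun m ↦ ?_)
  by_cases hm : m ≤ y <;> simp [hm, hT]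

/-- stochastic monotonicity of the size-biased tail distribution
μ̂^θ in θ. -/
theorem stmt18 (β θ θ' : ℝ) (hβ : 0 < β) (hθ : θ ≤ θ') (y : ℤ) :
    ∑' m : {m : ℤ // m ≤ y}, muhat β θ' (m : ℤ) ≤ ∑' m : {m : ℤ // m ≤ y}, muhat β θ (m : ℤ) := by
  have hp := fun z ↦ (mu_pos hβ θ z).le
  have hp' := fun z ↦ (mu_pos hβ θ' z).le
  have hsum := hasSum_crossWeight_mu hβ θ
  have hsum' := hasSum_crossWeight_mu hβ θ'
  rw [tsum_muhat_eq hβ, tsum_muhat_eq hβ, div_le_div_iff₀ (Varmu_pos hβ θ') (Varmu_pos hβ θ),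
    ← hsum.tsum_eq, ← hsum'.tsum_eq]
  refine four_functions_theorem_tsum
    (Set.indicator_nonneg fun x _ ↦ crossWeight_nonneg hp' x) (crossWeight_nonneg hp)
    (Set.indicator_nonneg fun x _ ↦ crossWeight_nonneg hp x) (crossWeight_nonneg hp')
    (fun x x' ↦ ?_) (hsum'.summable.indicator _) hsum.summable (hsum.summable.indicator _)
    hsum'.summable
  by_cases hx : x.2 ≤ y
  · have hinf : (x ⊓ x').2 ≤ y := inf_le_left.trans hx
    simpa [Set.indicator_apply, hx, hinf] using
      crossWeight_mul_le hp hp' (mu_mul_mu_le hβ hθ) x x'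
  · rw [Set.indicator_of_notMem (by simpa using hx), zero_mul]
    exact mul_nonneg (Set.indicator_nonneg (fun x _ ↦ crossWeight_nonneg hp x) _)
      (crossWeight_nonneg hp' _)
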